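/- Let N ≥ 1 and let z : Fin N → ℝ be strictly increasing with H_N(z_i) = 0 for every i (so z enumerates the N roots of the physicist's Hermite polynomial H_N). Then the discriminant-type identity ∏_{1≤i<j≤N} (z_j − z_i)² = 2^{−N(N−1)/2} ∏_{j=1}^N j^j holds. -/

import Mathlib

/-- Physicist's Hermite polynomials: `H 0 = 1`, `H 1 = 2x`,
`H (n+2) = 2x * H (n+1) - 2(n+1) * H n`. -/
noncomputable def physHermite : ℕ → Polynomial ℝ
  | 0 => 1
  | 1 => Polynomial.C 2 * Polynomial.X
  | (n + 2) => Polynomial.C 2 * Polynomial.X * physHermite (n + 1)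
      - Polynomial.C (2 * ((n : ℝ) + 1)) * physHermite n

open Polynomial

theorem physHermite_add_two (n : ℕ) :
    physHermite (n + 2) = C 2 * X * physHermite (n + 1) - C (2 * ((n : ℝ) + 1)) * physHermite n := by
  rw [physHermite]

theorem natDegree_physHermite_le (n : ℕ) : (physHermite n).natDegree ≤ n := by
  induction n using Nat.twoStepInduction with
  | zero => simp [physHermite]
  | one => simp [physHermite]
  | more n ih₀ ih₁ =>
    rw [physHermite_add_two]
    refine (natDegree_sub_le _ _).trans (max_le ?_ ?_)
    · refine natDegree_mul_le.trans ?_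
      have := natDegree_C_mul_le (2 : ℝ) X
      rw [natDegree_X] at this
      lia
    · exact (natDegree_C_mul_le _ _).trans (by lia)

theorem coeff_physHermite_self (n : ℕ) : (physHermite n).coeff n = 2 ^ n := by
  induction n using Nat.twoStepInduction with
  | zero => simp [physHermite]
  | one => simp [physHermite]
  | more n _ ih₁ =>
    have h : (physHermite n).coeff (n + 2) = 0 :=
      coeff_eq_zero_of_natDegree_lt ((natDegree_physHermite_le n).trans_lt (by lia))
    rw [physHermite_add_two, coeff_sub, mul_assoc, coeff_C_mul, coeff_C_mul, coeff_X_mul, ih₁, h]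
    ring

theorem natDegree_physHermite (n : ℕ) : (physHermite n).natDegree = n :=
  natDegree_eq_of_le_of_coeff_ne_zero (natDegree_physHermite_le n)
    (by rw [coeff_physHermite_self]; positivity)

theorem leadingCoeff_physHermite (n : ℕ) : (physHermite n).leadingCoeff = 2 ^ n := by
  rw [leadingCoeff, natDegree_physHermite, coeff_physHermite_self]

theorem physHermite_ne_zero (n : ℕ) : physHermite n ≠ 0 := by
  rw [← leadingCoeff_ne_zero, leadingCoeff_physHermite]
  positivity

theorem derivative_physHermite_succ (n : ℕ) :
    derivative (physHermite (n + 1)) = C (2 * ((n : ℝ) + 1)) * physHermite n := by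
  induction n using Nat.twoStepInduction with
  | zero => simp [physHermite]
  | one =>
    simp [physHermite]
    ring
  | more n ih₀ ih₁ =>
    rw [physHermite_add_two (n + 1), derivative_sub, derivative_mul, derivative_C_mul,
      derivative_C_mul, ih₁, ih₀, physHermite_add_two n]
    push_cast
    simp only [derivative_X, map_mul, map_add, map_natCast, map_one, map_ofNat]
    ring

theorem abs_resultant_physHermite_succ (n : ℕ) :
    |resultant (physHermite (n + 1)) (physHermite n) (n + 1) n|
      = 2 ^ (3 * (n * (n + 1) / 2)) * ∏ j ∈ Finset.Icc 1 n, (j : ℝ) ^ j := by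
  induction n with
  | zero => simp [physHermite]
  | succ n ih =>
    have hrec : physHermite (n + 2) = C (-(2 * ((n : ℝ) + 1))) * physHermite n
        + physHermite (n + 1) * (C 2 * X) := by
      rw [physHermite_add_two, C_neg]
      ring
    have hdeg : (C (2 : ℝ) * X).natDegree + (n + 1) ≤ n + 2 := by
      have := natDegree_C_mul_le (2 : ℝ) X
      rw [natDegree_X] at this
      lia
    have hexp : (n + 1) * (n + 1 + 1) / 2 = n * (n + 1) / 2 + (n + 1) := by
      rw [show (n + 1) * (n + 1 + 1) = n * (n + 1) + (n + 1) * 2 by ring,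
        Nat.add_mul_div_right _ _ two_pos]
    rw [hrec, resultant_add_mul_left _ _ _ _ _ hdeg (natDegree_physHermite_le _),
      resultant_C_mul_left, resultant_add_left_deg _ _ _ _ _ (natDegree_physHermite_le n),
      resultant_comm, coeff_physHermite_self]
    simp only [abs_mul, abs_pow, abs_neg, abs_one, one_pow, one_mul, ih]
    rw [Finset.prod_Icc_succ_top (by lia), hexp, abs_of_pos (by positivity : (0 : ℝ) < n + 1),
      abs_two, mul_pow]
    push_cast
    ring

theorem physHermite_eq_nodal {N : ℕ} {z : Fin N → ℝ} (hz : Function.Injective z)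
    (hroot : ∀ i, (physHermite N).eval (z i) = 0) :
    physHermite N = C (2 ^ N) * Lagrange.nodal Finset.univ z := by
  have h2 : (2 : ℝ) ^ N ≠ 0 := by positivity
  have hdeg : (physHermite N).degree = (C ((2 : ℝ) ^ N) * Lagrange.nodal Finset.univ z).degree := by
    rw [degree_C_mul h2, Lagrange.degree_nodal, degree_eq_natDegree (physHermite_ne_zero N),
      natDegree_physHermite, Finset.card_fin]
  refine eq_of_degree_sub_lt_of_eval_index_eq Finset.univ hz.injOn ?_ fun i _ => ?_
  · refine (degree_sub_lt_left hdeg (physHermite_ne_zero N) ?_).trans_eq ?_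
    · simp [leadingCoeff_physHermite, (Lagrange.nodal_monic (s := Finset.univ) (v := z)).leadingCoeff]
    · rw [degree_eq_natDegree (physHermite_ne_zero N), natDegree_physHermite, Finset.card_fin]
  · rw [hroot, eval_mul, Lagrange.eval_nodal_at_node (Finset.mem_univ i), mul_zero]

theorem resultant_nodal_left {ι : Type*} (s : Finset ι) (v : ι → ℝ) (g : ℝ[X]) {m n : ℕ}
    (hm : s.card = m) (hg : g.natDegree ≤ n) :
    resultant (Lagrange.nodal s v) g m n = ∏ i ∈ s, g.eval (v i) := by
  have h := resultant_prod_left s (fun i => X - C (v i)) g n (by simp) hg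
  rw [← Lagrange.nodal, Lagrange.natDegree_nodal, hm] at h
  simpa [hg] using h

theorem prod_Ioi_sq_sub_eq_prod_abs_sub {N : ℕ} (z : Fin N → ℝ) :
    ∏ i : Fin N, ∏ j ∈ Finset.Ioi i, (z j - z i) ^ 2
      = ∏ i, ∏ j ∈ Finset.univ.erase i, |z i - z j| := by
  simp_rw [← Finset.compl_singleton]
  rw [← Finset.prod_prod_Ioi_mul_eq_prod_prod_off_diag fun j i => |z i - z j|]
  refine Finset.prod_congr rfl fun i _ => Finset.prod_congr rfl fun j _ => ?_
  rw [abs_sub_comm (z i), abs_mul_abs_self, sq]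

/-- Discriminant identity for the roots of the physicist's Hermite polynomial:
`∏_{i<j} (z_j − z_i)² = 2^{−N(N−1)/2} ∏_{j=1}^N j^j`. -/
theorem stmt_8 (N : ℕ) (hN : 1 ≤ N) (z : Fin N → ℝ) (hz : StrictMono z)
    (hroot : ∀ i, (physHermite N).eval (z i) = 0) :
    ∏ i : Fin N, ∏ j ∈ Finset.Ioi i, (z j - z i) ^ 2
      = ((2 : ℝ) ^ (N * (N - 1) / 2))⁻¹ * ∏ j ∈ Finset.Icc 1 N, (j : ℝ) ^ j := by
  obtain ⟨n, rfl⟩ : ∃ n, N = n + 1 := ⟨N - 1, by lia⟩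
  have hfac := physHermite_eq_nodal hz.injective hroot
  have hderiv (i : Fin (n + 1)) :
      2 ^ (n + 1) * ∏ j ∈ Finset.univ.erase i, |z i - z j|
        = 2 * ((n : ℝ) + 1) * |(physHermite n).eval (z i)| := by
    have h := congrArg (fun p => |p.eval (z i)|) (derivative_physHermite_succ n)
    simp only [hfac, derivative_C_mul, eval_mul, eval_C, abs_mul,
      Lagrange.eval_nodal_derivative_eval_node_eq (Finset.mem_univ i), Lagrange.eval_nodal,
      Finset.abs_prod] at h
    rwa [abs_of_pos (by positivity : (0 : ℝ) < 2 ^ (n + 1)), abs_two,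
      abs_of_pos (by positivity : (0 : ℝ) < n + 1)] at h
  have hprod := Finset.prod_congr (rfl : Finset.univ = Finset.univ) fun i _ => hderiv i
  rw [Finset.prod_mul_distrib, Finset.prod_mul_distrib, Finset.prod_const, Finset.prod_const,
    Finset.card_fin, ← prod_Ioi_sq_sub_eq_prod_abs_sub] at hprod
  have hres := abs_resultant_physHermite_succ n
  rw [hfac, resultant_C_mul_left,
    resultant_nodal_left _ _ _ (Finset.card_fin _) (natDegree_physHermite_le n), abs_mul,
    Finset.abs_prod, abs_of_pos (by positivity : (0 : ℝ) < (2 ^ (n + 1)) ^ n)] at hres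
  obtain ⟨k, hk⟩ : ∃ k, n * (n + 1) = 2 * k := (Nat.even_mul_succ_self n).two_dvd
  rw [hk, Nat.mul_div_cancel_left _ two_pos] at hres
  rw [Nat.add_sub_cancel, mul_comm (n + 1) n, hk, Nat.mul_div_cancel_left _ two_pos,
    Finset.prod_Icc_succ_top (by lia), eq_inv_mul_iff_mul_eq₀ (by positivity)]
  have e₁ : ((2 : ℝ) ^ (n + 1)) ^ (n + 1) = 2 ^ (2 * k) * 2 ^ (n + 1) := by
    rw [← hk]
    ring
  have e₂ : ((2 : ℝ) ^ (n + 1)) ^ n = 2 ^ (2 * k) := by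
    rw [← hk]
    ring
  rw [e₁, mul_pow] at hprod
  rw [e₂] at hres
  have e₃ : (2 : ℝ) ^ (3 * k) = 2 ^ (2 * k) * 2 ^ k := by ring
  rw [e₃, mul_assoc] at hres
  have hres' := mul_left_cancel₀ (by positivity) hres
  rw [hres'] at hprod
  refine mul_left_cancel₀ (by positivity : (2 : ℝ) ^ k * 2 ^ (n + 1) ≠ 0) ?_
  push_cast
  linear_combination hprod
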